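/- arXiv:1505.04987 — 3 statements merged into one kernel-verified Lean document; each statement's English description precedes it below -/
import Mathlib

section
/- Let B be a generalized Boolean algebra. Then in the complete lattice of ideals of B every principal ideal ⟨a⟩ is a complemented element: the set J = {b ∈ B : b ⊓ a = ⊥} is an ideal of B satisfying ⟨a⟩ ⊓ J = ⊥ and ⟨a⟩ ⊔ J = ⊤ in the ideal lattice. -/
/-- The ideal of elements disjoint from `a` in a distributive lattice with a least element. -/
def disjointIdeal {B : Type*} [DistribLattice B] [OrderBot B] (a : B) : Order.Ideal B where
  carrier := {b | Disjoint b a}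
  lower' _ _ hcb hb := hb.mono_left hcb
  nonempty' := ⟨⊥, disjoint_bot_left⟩
  directed' b hb c hc := ⟨b ⊔ c, disjoint_sup_left.2 ⟨hb, hc⟩, le_sup_left, le_sup_right⟩

theorem mem_disjointIdeal {B : Type*} [DistribLattice B] [OrderBot B] {a b : B} :
    b ∈ disjointIdeal a ↔ Disjoint b a :=
  Iff.rfl

/-- In the ideal lattice of a generalized Boolean algebra every principal ideal `⟨a⟩` is
complemented: the set `{b | b ⊓ a = ⊥}` is an ideal `J` with `⟨a⟩ ⊓ J = ⊥` and `⟨a⟩ ⊔ J = ⊤`. -/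
theorem principal_ideal_complemented {B : Type*} [GeneralizedBooleanAlgebra B] (a : B) :
    ∃ J : Order.Ideal B, (∀ b : B, b ∈ J ↔ b ⊓ a = ⊥) ∧
      Order.Ideal.principal a ⊓ J = ⊥ ∧ Order.Ideal.principal a ⊔ J = ⊤ := by
  refine ⟨disjointIdeal a, fun b => disjoint_iff, le_bot_iff.1 fun x hx => ?_,
    top_le_iff.1 fun x _ => ?_⟩
  · obtain ⟨hxa, hxJ⟩ := Order.Ideal.mem_inf.1 hx
    rw [← Order.Ideal.principal_bot]
    exact (mem_disjointIdeal.1 hxJ) le_rfl (Order.Ideal.mem_principal.1 hxa)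
  · exact Order.Ideal.mem_sup.2 ⟨a, Order.Ideal.mem_principal_self, x \ a,
      mem_disjointIdeal.2 disjoint_sdiff_self_left, le_sup_sdiff⟩
end

section
/- Let E be a distributive lattice with a least element ⊥ such that every principal ideal ⟨a⟩ has a complement in the complete lattice of ideals of E (an ideal J with ⟨a⟩ ⊓ J = ⊥ and ⟨a⟩ ⊔ J = ⊤). Then for all a ≤ b in E there exists c ∈ E with a ⊓ c = ⊥ and a ⊔ c = b; that is, E is a generalized Boolean algebra. -/
/-- If every principal ideal of a distributive lattice with bottom is complemented in the
ideal lattice, then the lattice is a generalized Boolean algebra: every `a ≤ b` admits a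
relative complement. -/
theorem generalizedBoolean_of_principal_complemented {E : Type*} [DistribLattice E] [OrderBot E]
    (h : ∀ a : E, ∃ J : Order.Ideal E,
      Order.Ideal.principal a ⊓ J = ⊥ ∧ Order.Ideal.principal a ⊔ J = ⊤) :
    ∀ a b : E, a ≤ b → ∃ c : E, a ⊓ c = ⊥ ∧ a ⊔ c = b := by
  intro a b hab
  obtain ⟨J, hinf, hsup⟩ := h a
  have hb : b ∈ Order.Ideal.principal a ⊔ J := by
    rw [hsup]
    exact Set.mem_univ b
  obtain ⟨i, hi, j, hj, hbij⟩ := Order.Ideal.mem_sup.mp hb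
  have hia : i ≤ a := Order.Ideal.mem_principal.mp hi
  refine ⟨j ⊓ b, ?_, ?_⟩
  · have hmem : a ⊓ (j ⊓ b) ∈ Order.Ideal.principal a ⊓ J :=
      Order.Ideal.mem_inf.mpr ⟨Order.Ideal.mem_principal.mpr inf_le_left,
        J.lower (inf_le_right.trans inf_le_left) hj⟩
    rw [hinf, ← Order.Ideal.principal_bot, Order.Ideal.mem_principal] at hmem
    exact le_bot_iff.mp hmem
  · rw [sup_inf_left, sup_eq_right.mpr hab]
    exact inf_eq_right.mpr (hbij.trans (sup_le_sup_right hia j))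
end

section
/- Let X be a T0 topological space admitting a topological basis consisting of compact open sets which is closed under binary intersections. Then X is Hausdorff if and only if every compact open subset of X is closed (equivalently, if and only if X has a basis of clopen sets). -/
open TopologicalSpace in
/-- A T0 space with a basis of clopen sets is Hausdorff. -/
theorem TopologicalSpace.IsTopologicalBasis.t2Space_of_isClopen {X : Type*} [TopologicalSpace X]
    [T0Space X] {C : Set (Set X)} (hC : IsTopologicalBasis C) (hclopen : ∀ U ∈ C, IsClopen U) :
    T2Space X := by
  have separate : ∀ {x y : X} {U : Set X}, IsOpen U → x ∈ U → y ∉ U →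
      ∃ V : Set X, IsClopen V ∧ x ∈ V ∧ y ∉ V := by
    intro x y U hU hx hy
    obtain ⟨V, hV, hxV, hVU⟩ := hC.exists_subset_of_mem_open hx hU
    exact ⟨V, hclopen V hV, hxV, fun h => hy (hVU h)⟩
  refine ⟨fun x y hxy => ?_⟩
  obtain ⟨U, hU, ⟨hx, hy⟩ | ⟨hy, hx⟩⟩ := exists_isOpen_xor_mem hxy
  · obtain ⟨V, hV, hxV, hyV⟩ := separate hU hx hy
    exact ⟨V, Vᶜ, hV.isOpen, hV.compl.isOpen, hxV, hyV, disjoint_compl_right⟩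
  · obtain ⟨V, hV, hyV, hxV⟩ := separate hU hy hx
    exact ⟨Vᶜ, V, hV.compl.isOpen, hV.isOpen, hxV, hyV, disjoint_compl_left⟩

/-- A T0 space with a basis of compact open sets stable under binary intersections is
Hausdorff iff every compact open subset is closed, equivalently iff it has a basis of
clopen sets. -/
theorem t2_iff_compact_open_closed {X : Type*} [TopologicalSpace X] [T0Space X]
    (B : Set (Set X)) (hB : TopologicalSpace.IsTopologicalBasis B)
    (hBcompact : ∀ U ∈ B, IsCompact U)
    (hBinter : ∀ U ∈ B, ∀ V ∈ B, U ∩ V ∈ B) :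
    (T2Space X ↔ ∀ K : Set X, IsCompact K → IsOpen K → IsClosed K) ∧
    (T2Space X ↔ ∃ C : Set (Set X), TopologicalSpace.IsTopologicalBasis C ∧
      ∀ U ∈ C, IsClopen U) := by
  refine ⟨⟨fun _ K hK _ => hK.isClosed, fun h => ?_⟩, fun _ => ?_, ?_⟩
  · exact hB.t2Space_of_isClopen fun U hU =>
      ⟨h U (hBcompact U hU) (hB.isOpen hU), hB.isOpen hU⟩
  · exact ⟨B, hB, fun U hU => ⟨(hBcompact U hU).isClosed, hB.isOpen hU⟩⟩
  · rintro ⟨C, hC, hclopen⟩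
    exact hC.t2Space_of_isClopen hclopen
end
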